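/- Let K be a field with |K| ≥ s+1 where 1 ≤ s ≤ m-1, and let M ∈ K^{m×m} be an invertible companion matrix. Then the orthogonal complement (with respect to the trace form Tr(A B^t)) of span{I, M, …, M^{s-1}} in K^{m×m} is spanned by m² - s matrices of rank one. -/

import Mathlib

open Matrix

/-- The companion matrix of `x^m - a_m x^{m-1} - ⋯ - a_2 x - a_1`, whose bottom row is
`(a_1, …, a_m)` and which has ones on the superdiagonal. -/
def companionMat {K : Type*} [Field K] {m : ℕ} (a : Fin m → K) : Matrix (Fin m) (Fin m) K :=
  Matrix.of fun i j => if (i : ℕ) + 1 = m then a j else if (j : ℕ) = (i : ℕ) + 1 then 1 else 0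

/-- The orthogonal complement of `span {I, M, …, M^{s-1}}` with respect to the trace
bilinear form `(A, B) ↦ Tr(A Bᵀ)`. -/
def perpPow {K : Type*} [Field K] {m : ℕ} (M : Matrix (Fin m) (Fin m) K) (s : ℕ) :
    Submodule K (Matrix (Fin m) (Fin m) K) where
  carrier := {N | ∀ r < s, Matrix.trace (M ^ r * Nᵀ) = 0}
  add_mem' := by
    intro x y hx hy r hr
    simp [Matrix.transpose_add, Matrix.mul_add, hx r hr, hy r hr]
  zero_mem' := by intro r hr; simp
  smul_mem' := by
    intro c x hx r hr
    simp [Matrix.transpose_smul, Matrix.mul_smul, hx r hr]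

section helpers
open Polynomial

lemma refl_step {K V : Type*} [Field K] [AddCommGroup V] [Module K V] (C Y : Module.End K V)
    (e : V) (m s : ℕ) (hs : s + 1 ≤ m)
    (hcard : ((s + 1 : ℕ) : Cardinal) ≤ Cardinal.mk K)
    (hind : ∀ q : K[X], q.degree < m → aeval C q e = 0 → q = 0)
    (hY : ∀ v, ∃ h : K[X], h.degree < s ∧ Y v = aeval C h v)
    (he : Y e = 0) : Y (C e) = 0 := by
  have key : ∀ c : K, ∃ h : K[X], h.degree < s ∧ Y (C e) = aeval C (h * (X - Polynomial.C c)) e := by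
    intro c
    obtain ⟨h, hd, hh⟩ := hY (C e - c • e)
    refine ⟨h, hd, ?_⟩
    rw [map_sub, map_smul, he, smul_zero, sub_zero] at hh
    rw [hh, map_mul]
    simp [Module.algebraMap_end_apply]
  have hdeg : ∀ (h : K[X]) (c : K), h.degree < s →
      (h * (X - Polynomial.C c)).degree < ((s + 1 : ℕ) : WithBot ℕ) := by
    intro h c hd
    rcases eq_or_ne h 0 with rfl | h0
    · simp
    · rw [degree_mul, degree_X_sub_C]
      rw [degree_eq_natDegree h0] at hd ⊢
      have : h.natDegree < s := by exact_mod_cast hd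
      exact_mod_cast Nat.add_lt_add_right this 1
  obtain ⟨h0, hd0, hh0⟩ := key 0
  set q := h0 * (X - Polynomial.C (0 : K)) with hq
  have hqd := hdeg h0 0 hd0
  have hroot : ∀ c, q.eval c = 0 := by
    intro c
    obtain ⟨h, hd, hh⟩ := key c
    have hqd' := hdeg h c hd
    have : q - h * (X - Polynomial.C c) = 0 := by
      apply hind
      · refine lt_of_lt_of_le (lt_of_le_of_lt (degree_sub_le _ _) (max_lt hqd hqd')) ?_
        exact_mod_cast hs
      · rw [map_sub, LinearMap.sub_apply, ← hh0, ← hh, sub_self]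
    rw [sub_eq_zero.mp this]
    simp
  have hq0 : q = 0 := by
    obtain ⟨t, ht⟩ := Cardinal.exists_finset_eq_card (α := K) hcard
    refine Polynomial.eq_zero_of_degree_lt_of_eval_finset_eq_zero t ?_ (fun x _ => hroot x)
    rw [← ht]
    exact hqd
  rw [hh0, hq0]
  simp

lemma refl_all {K V : Type*} [Field K] [AddCommGroup V] [Module K V] (C Y : Module.End K V)
    (hC : Function.Injective C)
    (e : V) (m s : ℕ) (hs : s + 1 ≤ m)
    (hcard : ((s + 1 : ℕ) : Cardinal) ≤ Cardinal.mk K)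
    (hind : ∀ q : K[X], q.degree < m → aeval C q e = 0 → q = 0)
    (hY : ∀ v, ∃ h : K[X], h.degree < s ∧ Y v = aeval C h v) :
    ∃ h : K[X], h.degree < s ∧ ∀ k, Y ((C ^ k) e) = aeval C h ((C ^ k) e) := by
  obtain ⟨h, hd, hh⟩ := hY e
  refine ⟨h, hd, ?_⟩
  have hcomm : ∀ (q : K[X]) (k : ℕ) v, aeval C q ((C ^ k) v) = (C ^ k) (aeval C q v) := by
    intro q k v
    have : aeval C q * C ^ k = C ^ k * aeval C q := by
      have h1 : C ^ k = aeval C (X ^ k : K[X]) := by simp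
      rw [h1, ← map_mul, ← map_mul, mul_comm]
    exact congrArg (fun f : Module.End K V => f v) this
  have hY' : ∀ v, ∃ h' : K[X], h'.degree < s ∧ (Y - aeval C h) v = aeval C h' v := by
    intro v
    obtain ⟨h', hd', hh'⟩ := hY v
    refine ⟨h' - h, lt_of_le_of_lt (degree_sub_le _ _) (max_lt hd' hd), ?_⟩
    simp [hh']
  have hinj : ∀ k, Function.Injective (C ^ k : Module.End K V) := by
    intro k
    rw [Module.End.coe_pow]
    exact hC.iterate k
  have : ∀ k, (Y - aeval C h) ((C ^ k) e) = 0 := by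
    intro k
    induction k with
    | zero => simp [hh]
    | succ k ih =>
      have := refl_step C (Y - aeval C h) ((C ^ k) e) m s hs hcard ?_ hY' ih
      · rw [pow_succ']
        exact this
      · intro q hq h0
        rw [hcomm] at h0
        exact hind q hq (hinj k (by rw [h0, map_zero]))
  intro k
  simpa [sub_eq_zero] using this k

end helpers

section comp
variable {K : Type*} [Field K] {m : ℕ}

lemma comp_row [NeZero m] (a : Fin m → K) (k : ℕ) (hk : k < m) :
    (Pi.single 0 1 : Fin m → K) ᵥ* (companionMat a) ^ k = Pi.single ⟨k, hk⟩ 1 := by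
  induction k with
  | zero => simp
  | succ k ih =>
    rw [pow_succ, ← Matrix.vecMul_vecMul, ih (by omega)]
    ext j
    simp only [Matrix.single_one_vecMul, Matrix.row, companionMat, Matrix.of_apply]
    rw [if_neg (by omega)]
    simp [Pi.single_apply, Fin.ext_iff]

lemma comp_unit [NeZero m] (a : Fin m → K) (ha : a 0 ≠ 0) : IsUnit (companionMat a) := by
  rw [← Matrix.mulVec_injective_iff_isUnit]
  rw [← Matrix.coe_mulVecLin, injective_iff_map_eq_zero]
  intro v hv
  have h1 : ∀ j : Fin m, j ≠ 0 → v j = 0 := by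
    intro j hj
    have hj0 : (j : ℕ) ≠ 0 := fun h => hj (Fin.ext (by simpa using h))
    have := congrFun hv ⟨j - 1, by omega⟩
    simp only [Matrix.mulVecLin_apply, Matrix.mulVec, dotProduct, companionMat, Matrix.of_apply,
      Pi.zero_apply] at this
    rw [Finset.sum_eq_single j] at this
    · rw [if_neg (by omega), if_pos (by omega)] at this
      simpa using this
    · intro b _ hb
      have : (b : ℕ) ≠ j := fun h => hb (Fin.ext h)
      rw [if_neg (by omega), if_neg (by omega), zero_mul]
    · simp
  have hm : 0 < m := Nat.pos_of_ne_zero (NeZero.ne m)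
  have h2 := congrFun hv ⟨m - 1, by omega⟩
  simp only [Matrix.mulVecLin_apply, Matrix.mulVec, dotProduct, companionMat, Matrix.of_apply,
      Pi.zero_apply] at h2
  rw [Finset.sum_eq_single 0] at h2
  · rw [if_pos (by omega)] at h2
    ext j
    by_cases hj : j = 0
    · subst hj
      simpa [ha] using h2
    · exact h1 j hj
  · intro b _ hb
    rw [h1 b hb, mul_zero]
  · simp

lemma trace_vecMulVec' (P : Matrix (Fin m) (Fin m) K) (u v : Fin m → K) :
    Matrix.trace (P * (Matrix.vecMulVec u v)ᵀ) = (u ᵥ* P) ⬝ᵥ v := by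
  rw [Matrix.transpose_vecMulVec, Matrix.mul_vecMulVec, Matrix.trace_vecMulVec,
    ← Matrix.dotProduct_mulVec, dotProduct_comm]

lemma finrank_perp [NeZero m] (s : ℕ) (hsm : s ≤ m) (a : Fin m → K) :
    Module.finrank K (perpPow (companionMat a) s) = m ^ 2 - s := by
  let T : Matrix (Fin m) (Fin m) K →ₗ[K] (Fin s → K) :=
    { toFun := fun N r => Matrix.trace (companionMat a ^ (r : ℕ) * Nᵀ)
      map_add' := by intro x y; ext r; simp [Matrix.mul_add]
      map_smul' := by intro c x; ext r; simp }
  have hker : LinearMap.ker T = perpPow (companionMat a) s := by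
    ext N
    rw [LinearMap.mem_ker]
    constructor
    · intro h r hr
      exact congrFun h ⟨r, hr⟩
    · intro h
      ext r
      exact h r r.2
  have hsurj : LinearMap.range T = ⊤ := by
    rw [LinearMap.range_eq_top]
    intro y
    refine ⟨Matrix.vecMulVec (Pi.single 0 1) (fun j => if h : (j : ℕ) < s then y ⟨j, h⟩ else 0), ?_⟩
    ext r
    change Matrix.trace (companionMat a ^ (r : ℕ) * _) = _
    rw [trace_vecMulVec', comp_row a r (by omega)]
    simp
  have := LinearMap.finrank_range_add_finrank_ker T
  rw [hsurj, hker, finrank_top, Module.finrank_matrix] at this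
  simp at this
  rw [pow_two]
  omega

open Polynomial in
lemma main_refl [NeZero m] (s : ℕ) (hs1 : 0 < s) (hs : s + 1 ≤ m)
    (hcard : ((s + 1 : ℕ) : Cardinal) ≤ Cardinal.mk K)
    (a : Fin m → K) (ha : a 0 ≠ 0) (Z : Matrix (Fin m) (Fin m) K)
    (hZ : ∀ u v : Fin m → K, (∀ r < s, (u ᵥ* companionMat a ^ r) ⬝ᵥ v = 0) → (u ᵥ* Z) ⬝ᵥ v = 0) :
    ∃ c : ℕ → K, Z = ∑ r ∈ Finset.range s, c r • companionMat a ^ r := by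
  set M := companionMat a with hM
  let C : Module.End K (Fin m → K) := Matrix.vecMulLinear M
  let Y : Module.End K (Fin m → K) := Matrix.vecMulLinear Z
  have hpow : ∀ k u, (C ^ k) u = u ᵥ* M ^ k := by
    intro k u
    induction k with
    | zero => simp
    | succ k ih =>
      rw [pow_succ', pow_succ, ← Matrix.vecMul_vecMul, ← ih]; rfl
  have haev : ∀ (h : K[X]) (n : ℕ), 0 < n → h.degree < n → ∀ u,
      aeval C h u = ∑ r ∈ Finset.range n, h.coeff r • (u ᵥ* M ^ r) := by
    intro h n hn hd u
    rw [aeval_eq_sum_range' (n := n)]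
    · simp [LinearMap.sum_apply, hpow]
    · by_cases h0 : h = 0
      · subst h0
        simpa using hn
      · exact (natDegree_lt_iff_degree_lt h0).2 hd
  have hC : Function.Injective C := by
    have := (Matrix.vecMul_injective_iff_isUnit).2 (comp_unit a ha)
    exact this
  have hind : ∀ q : K[X], q.degree < m → aeval C q (Pi.single 0 1) = 0 → q = 0 := by
    intro q hq h0
    rw [haev q m (by omega) hq] at h0
    ext i
    by_cases hi : i < m
    · have := congrFun h0 ⟨i, hi⟩
      rw [Finset.sum_apply, Finset.sum_eq_single i] at this
      · simpa [hM, comp_row a i hi] using this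
      · intro b hb hbi
        rw [hM, comp_row a b (Finset.mem_range.1 hb)]
        simp [Pi.single_apply, Fin.ext_iff, Ne.symm hbi]
      · simp [hi]
    · rw [coeff_eq_zero_of_degree_lt, coeff_zero]
      exact lt_of_lt_of_le hq (by exact_mod_cast not_lt.1 hi)
  have hY : ∀ u, ∃ h : K[X], h.degree < s ∧ Y u = aeval C h u := by
    intro u
    have hmem : Y u ∈ Submodule.span K (Set.range fun r : Fin s => u ᵥ* M ^ (r : ℕ)) := by
      by_contra hn
      obtain ⟨f, hf, hle⟩ := Submodule.exists_le_ker_of_notMem hn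
      have hfd : ∀ w, f w = w ⬝ᵥ fun i => f (Pi.single i 1) := by
        intro w
        conv_lhs => rw [pi_eq_sum_univ' w]
        simp [dotProduct]
      apply hf
      rw [hfd]
      apply hZ
      intro r hr
      rw [← hfd]
      exact hle (Submodule.subset_span ⟨⟨r, hr⟩, rfl⟩)
    obtain ⟨c, hc⟩ := (Submodule.mem_span_range_iff_exists_fun K).1 hmem
    have hd : (∑ i : Fin s, Polynomial.C (c i) * X ^ (i : ℕ) : K[X]).degree < s :=
      degree_sum_fin_lt c
    refine ⟨_, hd, ?_⟩
    rw [← hc]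
    simp [map_sum, LinearMap.sum_apply, hpow, Module.algebraMap_end_apply]
  obtain ⟨h, hd, hh⟩ := refl_all C Y hC _ m s hs hcard hind hY
  refine ⟨h.coeff, ?_⟩
  ext i j
  have := hh i
  rw [haev h s hs1 hd, hpow, hM, comp_row a i i.2] at this
  have := congrFun this j
  simpa [Y, Finset.sum_apply, Matrix.sum_apply] using this

end comp

theorem stmt10 {K : Type*} [Field K] {m s : ℕ} [NeZero m]
    (hs1 : 1 ≤ s) (hsm : s ≤ m - 1)
    (hcard : ((s + 1 : ℕ) : Cardinal) ≤ Cardinal.mk K)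
    (a : Fin m → K) (ha : a 0 ≠ 0) :
    ∃ A : Fin (m ^ 2 - s) → Matrix (Fin m) (Fin m) K,
      (∀ i, (A i).rank = 1) ∧
      Submodule.span K (Set.range A) = perpPow (companionMat a) s := by
  set S : Set (Matrix (Fin m) (Fin m) K) := {N | N.rank = 1 ∧ N ∈ perpPow (companionMat a) s}
    with hS
  have hspan : Submodule.span K S = perpPow (companionMat a) s := by
    apply le_antisymm
    · rw [Submodule.span_le]
      exact fun N hN => hN.2
    · intro N hN
      by_contra hn
      obtain ⟨f, hf, hle⟩ := Submodule.exists_le_ker_of_notMem hn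
      let Z : Matrix (Fin m) (Fin m) K := Matrix.of fun i j => f (Matrix.single i j 1)
      have hfZ : ∀ B, f B = Matrix.trace (Z * Bᵀ) := by
        intro B
        conv_lhs => rw [Matrix.matrix_eq_sum_single B]
        simp only [map_sum, Matrix.trace, Matrix.diag, Matrix.mul_apply, Matrix.transpose_apply]
        refine Finset.sum_congr rfl fun i _ => Finset.sum_congr rfl fun j _ => ?_
        have : Matrix.single i j (B i j) = B i j • Matrix.single i j (1 : K) := by
          simp [Matrix.smul_single]
        rw [this, map_smul, smul_eq_mul, mul_comm]
        rfl
      obtain ⟨c, hc⟩ := main_refl s hs1 (by omega) hcard a ha Z (by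
        intro u v huv
        rw [← trace_vecMulVec', ← hfZ]
        by_cases h0 : Matrix.vecMulVec u v = 0
        · rw [h0, map_zero]
        · apply hle
          apply Submodule.subset_span
          refine ⟨?_, ?_⟩
          · apply le_antisymm (Matrix.rank_vecMulVec_le u v)
            rw [Nat.one_le_iff_ne_zero]
            intro h
            rw [Matrix.rank, Submodule.finrank_eq_zero, LinearMap.range_eq_bot] at h
            apply h0
            ext i j
            have := congrFun (LinearMap.congr_fun h (Pi.single j 1)) i
            simpa using this
          · intro r hr
            rw [trace_vecMulVec']
            exact huv r hr)
      apply hf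
      rw [hfZ, hc, Finset.sum_mul, Matrix.trace_sum]
      refine Finset.sum_eq_zero fun r hr => ?_
      rw [Matrix.smul_mul, Matrix.trace_smul, hN r (Finset.mem_range.1 hr), smul_zero]
  have hfin := finrank_perp s (by omega) a
  obtain ⟨A, hA, hA2, -⟩ := Submodule.exists_fun_fin_finrank_span_eq K S
  have hA3 := hA2.trans hspan
  have hn : Module.finrank K (Submodule.span K S) = m ^ 2 - s := by rw [hspan, hfin]
  refine ⟨fun i => A (Fin.cast hn.symm i), fun i => (hA _).1, ?_⟩
  rw [← hA3]
  congr 1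
  exact (finCongr hn.symm).surjective.range_comp A
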